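/- arXiv:1609.03638 — 3 statements merged into one kernel-verified Lean document; each statement's English description precedes it below -/
import Mathlib

section
/- Let G be an abelian group, let A and B be subgroups of G, and let x ∈ G and (y_j)_{j∈ℕ} be elements of G. If the coset x + A is contained in the countable union ⋃_{j∈ℕ} (y_j + B), then A itself is contained in a countable union of cosets of B, and consequently the index of the subgroup A ∩ B in A is countable. -/
open Pointwise

/-- If a coset `x + A` is contained in a countable union of cosets `y j + B`,
then `A` is contained in a countable union of cosets of `B`, and the index of
`A ∩ B` in `A` is countable. -/
theorem stmt1 (G : Type*) [AddCommGroup G] (A B : AddSubgroup G) (x : G) (y : ℕ → G)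
    (h : x +ᵥ (A : Set G) ⊆ ⋃ j, y j +ᵥ (B : Set G)) :
    (∃ z : ℕ → G, (A : Set G) ⊆ ⋃ j, z j +ᵥ (B : Set G)) ∧
      Countable (A ⧸ (A ⊓ B).addSubgroupOf A) := by
  have key : ∀ a : A, ∃ j, -y j + (x + a) ∈ B := fun a => by
    obtain ⟨j, hj⟩ := Set.mem_iUnion.mp (h (Set.vadd_mem_vadd_set a.2))
    exact ⟨j, by simpa [Set.mem_vadd_set_iff_neg_vadd_mem] using hj⟩
  refine ⟨⟨fun j => y j - x, fun a ha => ?_⟩, ?_⟩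
  · obtain ⟨j, hj⟩ := key ⟨a, ha⟩
    refine Set.mem_iUnion.mpr ⟨j, Set.mem_vadd_set.mpr ⟨_, hj, ?_⟩⟩
    simp only [vadd_eq_add]
    abel
  · choose f hf using key
    refine Function.Injective.countable
      (f := fun q : A ⧸ (A ⊓ B).addSubgroupOf A => f q.out) fun p q hpq => ?_
    rw [← QuotientAddGroup.out_eq' p, ← QuotientAddGroup.out_eq' q, QuotientAddGroup.eq,
      AddSubgroup.mem_addSubgroupOf]
    refine AddSubgroup.mem_inf.mpr ⟨SetLike.coe_mem _, ?_⟩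
    have hp := hf p.out
    rw [show f p.out = f q.out from hpq] at hp
    convert B.sub_mem (hf q.out) hp using 1
    push_cast
    abel
end

section
/- Let k be a field of characteristic zero, V a k-vector space equipped with an alternating bilinear form ⟨·,·⟩, and let G be a group acting k-linearly on V. Suppose G is generated by a set S of elements each of which acts on V as a transvection α ↦ α − ⟨α, δ_s⟩·δ_s for some vector δ_s ∈ V. Let Γ be a finite-index subgroup of G. Then every k-subspace H of V that is invariant under Γ is invariant under all of G. -/
/-- The `n`-th power of the transvection `α ↦ α - B α δ • δ` is `α ↦ α - n • (B α δ • δ)`. -/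
theorem Representation.pow_apply_of_transvection {k V G : Type*} [Field k] [AddCommGroup V]
    [Module k V] [Group G] {B : V →ₗ[k] V →ₗ[k] k} {ρ : Representation k G V} {s : G} {δ : V}
    (hδ : B δ δ = 0) (hs : ∀ α : V, ρ s α = α - B α δ • δ) (n : ℕ) (α : V) :
    ρ (s ^ n) α = α - ((n : k) * B α δ) • δ := by
  induction n with
  | zero => simp
  | succ n ih =>
    rw [pow_succ', map_mul, Module.End.mul_apply, ih, hs]
    simp only [map_sub, map_smul, LinearMap.sub_apply, LinearMap.smul_apply, hδ, smul_zero,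
      sub_zero, Nat.cast_succ, add_mul, one_mul, add_smul]
    abel

/-- If a group `G` acts linearly on `V` (char 0) and is generated by elements acting
as transvections attached to an alternating bilinear form, then any subspace invariant
under a finite-index subgroup `Γ` of `G` is invariant under all of `G`. -/
theorem stmt4 (k : Type*) [Field k] [CharZero k]
    (V : Type*) [AddCommGroup V] [Module k V]
    (B : V →ₗ[k] V →ₗ[k] k) (hB : ∀ v : V, B v v = 0)
    (G : Type*) [Group G] (ρ : Representation k G V)
    (S : Set G) (hS : Subgroup.closure S = ⊤)
    (htrans : ∀ s ∈ S, ∃ δ : V, ∀ α : V, ρ s α = α - B α δ • δ)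
    (Γ : Subgroup G) [Γ.FiniteIndex]
    (H : Submodule k V) (hH : ∀ γ ∈ Γ, ∀ x ∈ H, ρ γ x ∈ H) :
    ∀ g : G, ∀ x ∈ H, ρ g x ∈ H := by
  have key : ∀ s ∈ S, ∃ δ : V, (∀ α : V, ρ s α = α - B α δ • δ) ∧ ∀ x ∈ H, B x δ • δ ∈ H := by
    intro s hs
    obtain ⟨δ, hδ⟩ := htrans s hs
    refine ⟨δ, hδ, fun x hx => ?_⟩
    obtain ⟨n, hn, -, hmem⟩ :=
      Subgroup.exists_pow_mem_of_index_ne_zero (H := Γ) Subgroup.FiniteIndex.index_ne_zero s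
    have hn0 : (n : k) ≠ 0 := Nat.cast_ne_zero.mpr hn.ne'
    have h := H.sub_mem hx (hH _ hmem x hx)
    rw [Representation.pow_apply_of_transvection (hB δ) hδ, sub_sub_cancel, mul_smul] at h
    exact (H.smul_mem_iff hn0).mp h
  intro g
  have hg : g ∈ Subgroup.closure S := hS ▸ Subgroup.mem_top g
  induction hg using Subgroup.closure_induction'' with
  | one => simp
  | mem s hs =>
    obtain ⟨δ, hδ, hmem⟩ := key s hs
    intro x hx
    rw [hδ]
    exact H.sub_mem hx (hmem x hx)
  | inv_mem s hs =>
    obtain ⟨δ, hδ, hmem⟩ := key s hs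
    intro x hx
    have h : ρ s (x + B x δ • δ) = x := by simp [hδ, hB δ]
    rw [← h, ρ.inv_self_apply]
    exact H.add_mem hx (hmem x hx)
  | mul a b _ _ ha hb =>
    intro x hx
    rw [map_mul]
    exact ha _ (hb x hx)
end

section
/- Let k be a field of characteristic zero, V a k-vector space with an alternating bilinear form ⟨·,·⟩, and ρ : G → GL(V) an irreducible representation of a group G such that G is generated by elements acting as transvections α ↦ α − ⟨α, δ⟩·δ for vectors δ ∈ V, and such that every G-equivariant k-linear endomorphism of V is a scalar multiple of the identity. Consider the diagonal action of G on V × V, and let Γ be a finite-index subgroup of G. Then every Γ-invariant k-subspace W of V × V is either {0}, or all of V × V, or of the form {(a·v, b·v) : v ∈ V} for some (a, b) ∈ k² with (a, b) ≠ (0, 0); in particular, every nonzero proper Γ-invariant subspace is isomorphic to V as a k-vector space. -/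
/-- An element acting with `(σ s - 1) ^ 2 = 0` has powers `σ (s ^ n) = 1 + n (σ s - 1)`. -/
theorem Representation.pow_apply_of_sq_sub_one {k G M : Type*} [Field k] [Group G]
    [AddCommGroup M] [Module k M] (σ : Representation k G M) {s : G}
    (hs : ∀ m, σ s (σ s m - m) = σ s m - m) (n : ℕ) (m : M) :
    σ (s ^ n) m = m + (n : k) • (σ s m - m) := by
  induction n with
  | zero => simp
  | succ n ih =>
    rw [pow_succ', map_mul, Module.End.mul_apply, ih, map_add, map_smul, hs]
    push_cast
    module

/-- If a group is generated by elements acting by unipotents of index two, a subspace stable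
under a finite-index subgroup is stable under the whole group. -/
theorem Representation.mem_of_mem_finiteIndex {k G M : Type*} [Field k] [CharZero k] [Group G]
    [AddCommGroup M] [Module k M] (σ : Representation k G M) {S : Set G}
    (hS : Subgroup.closure S = ⊤)
    (hs : ∀ s ∈ S, ∀ m, σ s (σ s m - m) = σ s m - m)
    (Γ : Subgroup G) [Γ.FiniteIndex] (W : Submodule k M)
    (hW : ∀ γ ∈ Γ, ∀ m ∈ W, σ γ m ∈ W) (g : G) : ∀ m ∈ W, σ g m ∈ W := by
  have hg : g ∈ Subgroup.closure S := hS ▸ Subgroup.mem_top g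
  induction hg using Subgroup.closure_induction with
  | mem s h =>
    intro m hm
    obtain ⟨n, hn, -, hmem⟩ := Subgroup.exists_pow_mem_of_index_ne_zero
      (H := Γ) Subgroup.FiniteIndex.index_ne_zero s
    have h1 := hW _ hmem m hm
    rw [σ.pow_apply_of_sq_sub_one (hs s h), Submodule.add_mem_iff_right _ hm,
      Submodule.smul_mem_iff _ (Nat.cast_ne_zero.2 hn.ne')] at h1
    exact (Submodule.sub_mem_iff_left _ hm).1 h1
  | one => simp
  | mul x y _ _ hx hy =>
    intro m hm
    rw [map_mul]
    exact hx _ (hy m hm)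
  | inv x _ hx =>
    intro m hm
    obtain ⟨n, hn, -, hmem⟩ := Subgroup.exists_pow_mem_of_index_ne_zero
      (H := Γ) Subgroup.FiniteIndex.index_ne_zero x
    obtain ⟨n, rfl⟩ := Nat.exists_eq_succ_of_ne_zero hn.ne'
    have hpow : ∀ j : ℕ, σ (x ^ j) m ∈ W := by
      intro j
      induction j with
      | zero => simpa
      | succ j ih =>
        rw [pow_succ', map_mul]
        exact hx _ ih
    have hx' : x⁻¹ = (x ^ n.succ)⁻¹ * x ^ n := by
      rw [Nat.succ_eq_add_one, pow_succ]; group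
    rw [hx', map_mul]
    exact hW _ (Γ.inv_mem hmem) _ (hpow n)

/-- Stable subspaces of the square of an irreducible representation whose equivariant
endomorphisms are scalars. -/
theorem Representation.stable_submodule_prod_self {k G V : Type*} [Field k] [Group G]
    [AddCommGroup V] [Module k V] (ρ : Representation k G V)
    (hirr : ∀ W : Submodule k V, (∀ g : G, ∀ v ∈ W, ρ g v ∈ W) → W = ⊥ ∨ W = ⊤)
    (hschur : ∀ f : V →ₗ[k] V, (∀ (g : G) (v : V), f (ρ g v) = ρ g (f v)) →
      ∃ c : k, f = c • LinearMap.id)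
    (W : Submodule k (V × V)) (hW : ∀ g, ∀ p ∈ W, (ρ g p.1, ρ g p.2) ∈ W) :
    W = ⊥ ∨ W = ⊤ ∨
      ∃ a b : k, (a, b) ≠ (0, 0) ∧
        W = LinearMap.range ((a • (LinearMap.id : V →ₗ[k] V)).prod
              (b • (LinearMap.id : V →ₗ[k] V))) := by
  have hfst := hirr (W.map (LinearMap.fst k V V)) (by
    rintro g _ ⟨p, hp, rfl⟩
    exact ⟨_, hW g p hp, rfl⟩)
  have hsnd := hirr (W.comap (LinearMap.inr k V V)) (by
    intro g v hv
    simpa using hW g _ hv)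
  rcases hfst with h1 | h1
  · have hzero : ∀ p ∈ W, p.1 = 0 := fun p hp => by
      have : p.1 ∈ W.map (LinearMap.fst k V V) := ⟨p, hp, rfl⟩
      simpa [h1] using this
    rcases hsnd with h2 | h2
    · left
      rw [eq_bot_iff]
      rintro ⟨x, y⟩ hp
      obtain rfl : x = 0 := hzero _ hp
      have : y ∈ W.comap (LinearMap.inr k V V) := hp
      rw [h2, Submodule.mem_bot] at this
      simp [this]
    · refine Or.inr (Or.inr ⟨0, 1, by simp, le_antisymm ?_ ?_⟩)
      · rintro ⟨x, y⟩ hp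
        obtain rfl : x = 0 := hzero _ hp
        exact ⟨y, by simp⟩
      · rintro _ ⟨y, rfl⟩
        have : y ∈ W.comap (LinearMap.inr k V V) := h2 ▸ Submodule.mem_top
        simpa using this
  · have hsurj : ∀ x, ∃ y, (x, y) ∈ W := fun x => by
      have : x ∈ W.map (LinearMap.fst k V V) := h1 ▸ Submodule.mem_top
      obtain ⟨⟨_, y⟩, hp, rfl⟩ := this
      exact ⟨y, hp⟩
    rcases hsnd with h2 | h2
    · have huniq : ∀ {x y z}, (x, y) ∈ W → (x, z) ∈ W → y = z := fun {x y z} hy hz => by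
        have : y - z ∈ W.comap (LinearMap.inr k V V) := by simpa using W.sub_mem hy hz
        rw [h2, Submodule.mem_bot] at this
        exact sub_eq_zero.1 this
      choose f hf using hsurj
      let F : V →ₗ[k] V :=
        { toFun := f
          map_add' := fun x y => huniq (hf _) (W.add_mem (hf x) (hf y))
          map_smul' := fun c x => huniq (hf _) (W.smul_mem c (hf x)) }
      obtain ⟨c, hc⟩ := hschur F fun g v => huniq (hf _) (hW g _ (hf v))
      have hfc : ∀ v, f v = c • v := fun v => LinearMap.congr_fun hc v
      refine Or.inr (Or.inr ⟨1, c, by simp, le_antisymm ?_ ?_⟩)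
      · rintro ⟨x, y⟩ hp
        exact ⟨x, by simp [← hfc, huniq hp (hf x)]⟩
      · rintro _ ⟨x, rfl⟩
        simpa [hfc] using hf x
    · refine Or.inr (Or.inl (eq_top_iff.2 ?_))
      rintro ⟨x, y⟩ -
      obtain ⟨z, hz⟩ := hsurj x
      have : y - z ∈ W.comap (LinearMap.inr k V V) := h2 ▸ Submodule.mem_top
      simpa using W.add_mem hz this

/-- Char-zero version with finite-index subgroups: if `G` acts irreducibly on `V`,
is generated by transvections for an alternating form, and has only scalar equivariant
endomorphisms, then every subspace of `V × V` (diagonal action) invariant under a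
finite-index subgroup `Γ ≤ G` is `{0}`, all of `V × V`, or
`{(a • v, b • v) : v ∈ V}` with `(a, b) ≠ (0, 0)`; in particular every nonzero proper
such subspace is isomorphic to `V` as a `k`-vector space. -/
theorem stmt8 (k : Type*) [Field k] [CharZero k]
    (G : Type*) [Group G]
    (V : Type*) [AddCommGroup V] [Module k V]
    (B : V →ₗ[k] V →ₗ[k] k) (hB : ∀ v : V, B v v = 0)
    (ρ : Representation k G V)
    (hirr : ∀ W : Submodule k V, (∀ g : G, ∀ v ∈ W, ρ g v ∈ W) → W = ⊥ ∨ W = ⊤)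
    (S : Set G) (hS : Subgroup.closure S = ⊤)
    (htrans : ∀ s ∈ S, ∃ δ : V, ∀ α : V, ρ s α = α - B α δ • δ)
    (hschur : ∀ f : V →ₗ[k] V, (∀ (g : G) (v : V), f (ρ g v) = ρ g (f v)) →
      ∃ c : k, f = c • LinearMap.id)
    (Γ : Subgroup G) [Γ.FiniteIndex]
    (W : Submodule k (V × V))
    (hW : ∀ γ ∈ Γ, ∀ p ∈ W, (ρ γ p.1, ρ γ p.2) ∈ W) :
    (W = ⊥ ∨ W = ⊤ ∨
      ∃ a b : k, (a, b) ≠ (0, 0) ∧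
        W = LinearMap.range ((a • (LinearMap.id : V →ₗ[k] V)).prod
              (b • (LinearMap.id : V →ₗ[k] V)))) ∧
      (W ≠ ⊥ → W ≠ ⊤ → Nonempty (W ≃ₗ[k] V)) := by
  have hG := (ρ.prod ρ).mem_of_mem_finiteIndex hS (by
    intro s hs p
    obtain ⟨δ, hδ⟩ := htrans s hs
    ext <;> simp [hδ, hB]) Γ W hW
  have key := ρ.stable_submodule_prod_self hirr hschur W hG
  refine ⟨key, fun hbot htop => ?_⟩
  obtain h | h | ⟨a, b, hab, rfl⟩ := key
  · exact absurd h hbot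
  · exact absurd h htop
  · refine ⟨(LinearEquiv.ofInjective _ ?_).symm⟩
    rw [← LinearMap.ker_eq_bot, LinearMap.ker_eq_bot']
    intro v hv
    by_contra hv0
    simp_all
end
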